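/- arXiv:2507.07782 — 2 statements merged into one kernel-verified Lean document; each statement's English description precedes it below -/
import Mathlib

section
/- Let (X,d) be a compact metric space, f : X → X continuous with h_top(f) < +∞, and φ, ψ ∈ C(X,ℝ) with ψ > 0. Then φ freezes at β₀ (i.e. there exists μ ∈ M(X,f) that is an equilibrium state of P_ψ(βφ) for all β ≥ β₀) if and only if both of the following hold: (1) P_ψ(βφ) = β·Max^ψ(φ) + h_∞^ψ(φ) for every β ≥ β₀; (2) there exists β₁ > β₀ such that P_ψ(β₁φ) has at least one equilibrium state. -/
open Filter Set Topology MeasureTheory ENNReal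

variable {X : Type*}

/-- Birkhoff sum `S_n φ = ∑_{i<n} φ ∘ f^i`. -/
def birkhoff (f : X → X) (φ : X → ℝ) (n : ℕ) (x : X) : ℝ :=
  ∑ i ∈ Finset.range n, φ (f^[i] x)

section Metric
variable [MetricSpace X]

/-- `F` is an `(n,ε)`-spanning set of `Z`: every `y ∈ Z` is within Bowen distance
`d_n ≤ ε` of some point of `F`. -/
def IsSpanningSetOf (f : X → X) (n : ℕ) (ε : ℝ) (Z : Set X) (F : Finset X) : Prop :=
  ∀ y ∈ Z, ∃ x ∈ F, ∀ i < n, dist (f^[i] x) (f^[i] y) ≤ ε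

/-- `E` is an `(n,ε)`-separated set of `Z`: `E ⊆ Z` and distinct points of `E` are at
Bowen distance `d_n > ε`. -/
def IsSeparatedSetOf (f : X → X) (n : ℕ) (ε : ℝ) (Z : Set X) (E : Finset X) : Prop :=
  (E : Set X) ⊆ Z ∧ ∀ x ∈ E, ∀ y ∈ E, x ≠ y → ∃ i < n, ε < dist (f^[i] x) (f^[i] y)

/-- `S_T = {n : ℕ | ∃ x, S_nψ(x) ≤ T < S_{n+1}ψ(x)}`. -/
def inducedST (f : X → X) (ψ : X → ℝ) (T : ℝ) : Set ℕ :=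
  {n | ∃ x : X, birkhoff f ψ n x ≤ T ∧ T < birkhoff f ψ (n + 1) x}

/-- `X_n = {x | S_nψ(x) ≤ T < S_{n+1}ψ(x)}`. -/
def inducedXn (f : X → X) (ψ : X → ℝ) (T : ℝ) (n : ℕ) : Set X :=
  {x | birkhoff f ψ n x ≤ T ∧ T < birkhoff f ψ (n + 1) x}

/-- `Q_{ψ,T}(f,φ,ε)`: infimum over families of `(n,ε)`-spanning sets of the `X_n`, `n ∈ S_T`,
of `∑_{n ∈ S_T} ∑_{x ∈ F_n} e^{S_nφ(x)}`. -/
noncomputable def inducedQ (f : X → X) (ψ φ : X → ℝ) (T ε : ℝ) : ℝ≥0∞ :=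
  ⨅ (F : ℕ → Finset X) (_ : ∀ n ∈ inducedST f ψ T,
      IsSpanningSetOf f n ε (inducedXn f ψ T n) (F n)),
    ∑' n : inducedST f ψ T, ∑ x ∈ F n, ENNReal.ofReal (Real.exp (birkhoff f φ n x))

/-- `P_{ψ,T}(f,φ,ε)`: supremum over families of `(n,ε)`-separated sets of the `X_n`, `n ∈ S_T`,
of `∑_{n ∈ S_T} ∑_{x ∈ E_n} e^{S_nφ(x)}`. -/
noncomputable def inducedPsep (f : X → X) (ψ φ : X → ℝ) (T ε : ℝ) : ℝ≥0∞ :=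
  ⨆ (E : ℕ → Finset X) (_ : ∀ n ∈ inducedST f ψ T,
      IsSeparatedSetOf f n ε (inducedXn f ψ T n) (E n)),
    ∑' n : inducedST f ψ T, ∑ x ∈ E n, ENNReal.ofReal (Real.exp (birkhoff f φ n x))

/-- The ψ-induced topological pressure
`P_ψ(φ) = lim_{ε→0⁺} limsup_{T→∞} (1/T) log Q_{ψ,T}(f,φ,ε)`, the limit as `ε → 0⁺`
being realized as a `limsup` along `𝓝[>] 0` (since `ε ↦ limsup_T …` is monotone,
this coincides with the limit). -/
noncomputable def inducedPressure (f : X → X) (ψ φ : X → ℝ) : EReal :=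
  limsup (fun ε : ℝ =>
    limsup (fun T : ℝ => ENNReal.log (inducedQ f ψ φ T ε) * ((T⁻¹ : ℝ) : EReal)) atTop)
    (𝓝[>] (0 : ℝ))

/-- Topological entropy `h_top(f) = P_ψ(0)` with `ψ ≡ 1`. -/
noncomputable def topEntropy (f : X → X) : EReal :=
  inducedPressure f (fun _ => 1) (fun _ => 0)

end Metric
section Meas
variable [MetricSpace X] [MeasurableSpace X] [BorelSpace X]

/-- Entropy of the finite measurable partition of `X` induced by a map `q` into a finite
type: `H(q) = ∑_s -μ(q⁻¹{s}) log μ(q⁻¹{s})`. -/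
noncomputable def mapEntropy {S : Type*} [Fintype S] (μ : Measure X) (q : X → S) : ℝ :=
  ∑ s : S, Real.negMulLog ((μ (q ⁻¹' {s})).toReal)

/-- Kolmogorov–Sinai (measure-theoretic) entropy `h_μ(f)`: the supremum, over finite
measurable partitions (encoded as measurable maps `p : X → Fin k`), of
`lim_n (1/n) H(⋁_{i<n} f^{-i} p)`; the limit exists by subadditivity and is
realized here as a `liminf`. -/
noncomputable def measEntropy (f : X → X) (μ : Measure X) : EReal :=
  ⨆ (k : ℕ) (p : X → Fin k) (_ : Measurable p),
    liminf (fun n : ℕ =>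
      (((n : ℝ)⁻¹ * mapEntropy μ (fun x (i : Fin n) => p (f^[i] x)) : ℝ) : EReal)) atTop

/-- The set `M(X,f)` of `f`-invariant Borel probability measures on `X`. -/
def invMeasures (f : X → X) : Set (Measure X) :=
  {μ | IsProbabilityMeasure μ ∧ ∀ B : Set X, MeasurableSet B → μ (f ⁻¹' B) = μ B}

/-- `μ` is an equilibrium state of `P_ψ(φ)`:
`μ ∈ M(X,f)` and `P_ψ(φ) = (h_μ(f) + ∫φ dμ)/(∫ψ dμ)`. -/
noncomputable def equilibriumStates (f : X → X) (ψ φ : X → ℝ) : Set (Measure X) :=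
  {μ | μ ∈ invMeasures f ∧
    inducedPressure f ψ φ =
      (measEntropy f μ + ((∫ x, φ x ∂μ : ℝ) : EReal)) / (((∫ x, ψ x ∂μ : ℝ) : EReal))}

end Meas

section Freeze
variable [MetricSpace X] [MeasurableSpace X] [BorelSpace X]

/-- `Max^ψ(φ) = sup_{μ ∈ M(X,f)} (∫φ dμ)/(∫ψ dμ)`. -/
noncomputable def maxRatio (f : X → X) (ψ φ : X → ℝ) : ℝ :=
  ⨆ ν : invMeasures f, (∫ x, φ x ∂(ν : Measure X)) / (∫ x, ψ x ∂(ν : Measure X))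

/-- `M_max^ψ(φ) = {μ ∈ M(X,f) : (∫φ dμ)/(∫ψ dμ) = Max^ψ(φ)}`. -/
def maxSet (f : X → X) (ψ φ : X → ℝ) : Set (Measure X) :=
  {μ ∈ invMeasures f |
    (∫ x, φ x ∂μ) / (∫ x, ψ x ∂μ) = maxRatio f ψ φ}

/-- `h_∞^ψ(φ) = sup{h_μ(f)/(∫ψ dμ) : μ ∈ M_max^ψ(φ)}`. -/
noncomputable def hInfty (f : X → X) (ψ φ : X → ℝ) : EReal :=
  ⨆ μ : maxSet f ψ φ, measEntropy f (μ : Measure X) / (((∫ x, ψ x ∂(μ : Measure X) : ℝ)) : EReal)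

end Freeze

theorem birkhoff_add (f : X → X) (g : X → ℝ) (m n : ℕ) (x : X) :
    birkhoff f g (m + n) x = birkhoff f g m x + birkhoff f g n (f^[m] x) :=
  birkhoffSum_add f g m n x

theorem birkhoff_le_nsmul {f : X → X} {g : X → ℝ} {C : ℝ} (hg : ∀ x, g x ≤ C) (n : ℕ) (x : X) :
    birkhoff f g n x ≤ n * C := by
  simpa [birkhoff] using Finset.sum_le_card_nsmul (Finset.range n) (fun i => g (f^[i] x)) C
    fun i _ => hg _

theorem nsmul_le_birkhoff {f : X → X} {g : X → ℝ} {C : ℝ} (hg : ∀ x, C ≤ g x) (n : ℕ) (x : X) :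
    n * C ≤ birkhoff f g n x := by
  simpa [birkhoff] using Finset.card_nsmul_le_sum (Finset.range n) (fun i => g (f^[i] x)) C
    fun i _ => hg _

theorem sum_ofFn_take_mul_drop {A : Type*} [Fintype A] (F G : List A → ℝ) {m n N : ℕ}
    (h : m + n = N) :
    ∑ a : Fin N → A, F ((List.ofFn a).take m) * G ((List.ofFn a).drop m) =
      (∑ a : Fin m → A, F (List.ofFn a)) * ∑ a : Fin n → A, G (List.ofFn a) := by
  subst h
  rw [← (Fin.appendEquiv m n).sum_comp, Fintype.sum_prod_type, Finset.sum_mul_sum]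
  refine Finset.sum_congr rfl fun a _ => Finset.sum_congr rfl fun b _ => ?_
  have hl : (List.ofFn a).length = m := List.length_ofFn
  simp only [Fin.appendEquiv, Equiv.coe_fn_mk, List.ofFn_fin_append]
  rw [List.take_left' hl, List.drop_left' hl]

theorem sum_ofFn_succ {A : Type*} [Fintype A] (F : List A → ℝ) (n : ℕ) :
    ∑ a : Fin (n + 1) → A, F (List.ofFn a) =
      ∑ b : A, ∑ a : Fin n → A, F (b :: List.ofFn a) := by
  rw [← (Fin.consEquiv fun _ => A).sum_comp, Fintype.sum_prod_type]
  refine Finset.sum_congr rfl fun a _ => Finset.sum_congr rfl fun b _ => ?_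
  simp [Fin.consEquiv]

theorem ofFn_orbit_take {A : Type*} (f : X → X) (p : X → A) {m n N : ℕ} (h : m + n = N) (x : X) :
    (List.ofFn fun j : Fin N => p (f^[j] x)).take m = List.ofFn fun j : Fin m => p (f^[j] x) := by
  subst h
  rw [List.ofFn_add, List.take_left' List.length_ofFn]
  rfl

theorem ofFn_orbit_drop {A : Type*} (f : X → X) (p : X → A) {m n N : ℕ} (h : m + n = N) (x : X) :
    (List.ofFn fun j : Fin N => p (f^[j] x)).drop m =
      List.ofFn fun j : Fin n => p (f^[j] (f^[m] x)) := by
  subst h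
  rw [List.ofFn_add, List.drop_left' List.length_ofFn]
  simp only [Fin.val_natAdd, ← Function.iterate_add_apply, add_comm]

/-- If every orbit starts with a block from a finite family, with block weights of total mass at
most one that dominate `exp (S_n G)`, then concatenating blocks yields, for every `N`,
subprobability weights on words of length `N` that dominate `exp (S_N G)` up to a constant. -/
theorem exists_word_weights {A ι : Type*} [Fintype A] [Nonempty A] (f : X → X) (p : X → A)
    (s : Finset ι) (len : ι → ℕ) (B : ι → List A → ℝ) (L : ℕ)
    (hlen : ∀ i ∈ s, 1 ≤ len i ∧ len i ≤ L) (hB : ∀ i ∈ s, ∀ l, 0 ≤ B i l)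
    (hsum : ∑ i ∈ s, ∑ a : Fin (len i) → A, B i (List.ofFn a) ≤ 1)
    (G : X → ℝ) (C : ℝ) (hC : 0 ≤ C) (hG : ∀ x, G x ≤ C)
    (hcov : ∀ x, ∃ i ∈ s, Real.exp (birkhoff f G (len i) x) ≤
      B i (List.ofFn fun j : Fin (len i) => p (f^[j] x))) :
    ∃ c : ℝ, 0 < c ∧ ∀ N : ℕ, ∃ w : List A → ℝ, (∀ l, 0 ≤ w l) ∧
      ∑ a : Fin N → A, w (List.ofFn a) ≤ 1 ∧
      ∀ x, c * Real.exp (birkhoff f G N x) ≤ w (List.ofFn fun j : Fin N => p (f^[j] x)) := by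
  set k : ℝ := (Fintype.card A : ℝ) with hk
  have hk1 : 1 ≤ k := by
    rw [hk]; exact_mod_cast Fintype.card_pos
  set K : ℝ := k * Real.exp C with hK
  have hK1 : 1 ≤ K := one_le_mul_of_one_le_of_one_le hk1 (Real.one_le_exp hC)
  have hc : 0 < (K ^ L)⁻¹ := by positivity
  refine ⟨(K ^ L)⁻¹, hc, fun N => ?_⟩
  induction N using Nat.strong_induction_on with
  | _ N ih =>
  rcases lt_or_ge N L with hN | hN
  · refine ⟨fun _ => (k ^ N)⁻¹, fun _ => by positivity, ?_, fun x => ?_⟩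
    · simp only [Finset.sum_const, Finset.card_univ, Fintype.card_fun, Fintype.card_fin,
        nsmul_eq_mul, Nat.cast_pow]
      rw [mul_inv_cancel₀ (by positivity)]
    · calc (K ^ L)⁻¹ * Real.exp (birkhoff f G N x) ≤ (K ^ N)⁻¹ * Real.exp (N * C) := by
            gcongr
            exact birkhoff_le_nsmul hG N x
        _ = (k ^ N)⁻¹ := by
            rw [hK, mul_pow, ← Real.exp_nat_mul]
            field_simp
  · have ih' : ∀ m, ∃ w : List A → ℝ, m < N → (∀ l, 0 ≤ w l) ∧
        ∑ a : Fin m → A, w (List.ofFn a) ≤ 1 ∧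
        ∀ x, (K ^ L)⁻¹ * Real.exp (birkhoff f G m x) ≤
          w (List.ofFn fun j : Fin m => p (f^[j] x)) := by
      intro m
      by_cases hm : m < N
      · obtain ⟨w, hw⟩ := ih m hm
        exact ⟨w, fun _ => hw⟩
      · exact ⟨0, fun h => absurd h hm⟩
    choose W hW using ih'
    have hlt : ∀ i ∈ s, N - len i < N := fun i hi => by have := hlen i hi; omega
    have hadd : ∀ i ∈ s, len i + (N - len i) = N := fun i hi => by have := hlen i hi; omega
    refine ⟨fun l => ∑ i ∈ s, B i (l.take (len i)) * W (N - len i) (l.drop (len i)),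
      fun l => Finset.sum_nonneg fun i hi => mul_nonneg (hB i hi _) ((hW _ (hlt i hi)).1 _),
      ?_, fun x => ?_⟩
    · rw [Finset.sum_comm]
      refine (Finset.sum_le_sum fun i hi => ?_).trans hsum
      rw [sum_ofFn_take_mul_drop _ _ (hadd i hi)]
      exact mul_le_of_le_one_right (Finset.sum_nonneg fun _ _ => hB i hi _) (hW _ (hlt i hi)).2.1
    · obtain ⟨i, hi, hix⟩ := hcov x
      refine le_trans ?_ (Finset.single_le_sum (f := fun i => B i (List.take (len i) _) *
        W (N - len i) (List.drop (len i) _)) (fun j hj => mul_nonneg (hB j hj _)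
          ((hW _ (hlt j hj)).1 _)) hi)
      rw [ofFn_orbit_take f p (hadd i hi), ofFn_orbit_drop f p (hadd i hi)]
      have hb : birkhoff f G N x =
          birkhoff f G (len i) x + birkhoff f G (N - len i) (f^[len i] x) := by
        rw [← birkhoff_add, hadd i hi]
      rw [hb, Real.exp_add, mul_left_comm]
      exact mul_le_mul hix ((hW _ (hlt i hi)).2.2 _) (by positivity) (hB i hi _)

/-- Product of the kernel `u` along the orbit of `y`, evaluated on a word. -/
def orbitWeight {A : Type*} (f : X → X) (u : X → A → ℝ) : X → List A → ℝ
  | _, [] => 1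
  | y, a :: l => u y a * orbitWeight f u (f y) l

theorem orbitWeight_nonneg {A : Type*} {f : X → X} {u : X → A → ℝ} (hu : ∀ y a, 0 ≤ u y a)
    (l : List A) (y : X) : 0 ≤ orbitWeight f u y l := by
  induction l generalizing y with
  | nil => simp [orbitWeight]
  | cons a l ih => exact mul_nonneg (hu y a) (ih _)

theorem sum_orbitWeight {A : Type*} [Fintype A] {f : X → X} {u : X → A → ℝ}
    (hu : ∀ y, ∑ a, u y a = 1) (n : ℕ) (y : X) :
    ∑ a : Fin n → A, orbitWeight f u y (List.ofFn a) = 1 := by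
  induction n generalizing y with
  | zero => simp [orbitWeight]
  | succ n ih =>
    rw [sum_ofFn_succ]
    simp only [orbitWeight, ← Finset.mul_sum, ih, mul_one, hu]

theorem exp_birkhoff_le_orbitWeight {A : Type*} {f : X → X} {u : X → A → ℝ} {p : X → A}
    {V : X → ℝ} (n : ℕ) (x y : X)
    (h : ∀ i < n, Real.exp (V (f^[i] x)) ≤ u (f^[i] y) (p (f^[i] x))) :
    Real.exp (birkhoff f V n x) ≤ orbitWeight f u y (List.ofFn fun j : Fin n => p (f^[j] x)) := by
  induction n generalizing x y with
  | zero => simp [orbitWeight, birkhoff]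
  | succ n ih =>
    have h0 := h 0 n.succ_pos
    have h1 := ih (f x) (f y) fun i hi => h (i + 1) (Nat.succ_lt_succ hi)
    have hb : birkhoff f V (n + 1) x = V x + birkhoff f V n (f x) := birkhoffSum_succ' f V n x
    rw [hb, Real.exp_add, List.ofFn_succ]
    exact mul_le_mul h0 h1 (Real.exp_pos _).le ((Real.exp_pos _).le.trans h0)

/-- Gibbs' inequality: subprobability weights dominating `exp G` bound the entropy by `-∫ G`. -/
theorem mapEntropy_le_neg_integral [MeasurableSpace X] {S : Type*} [Fintype S] [MeasurableSpace S]
    [MeasurableSingletonClass S] (μ : Measure X) [IsProbabilityMeasure μ] (q : X → S)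
    (hq : Measurable q) (w : S → ℝ) (hw : ∀ a, 0 ≤ w a) (hsum : ∑ a, w a ≤ 1) (G : X → ℝ)
    (hG : Integrable G μ) (hGw : ∀ x, Real.exp (G x) ≤ w (q x)) :
    mapEntropy μ q ≤ -∫ x, G x ∂μ := by
  have hprob : IsProbabilityMeasure (μ.map q) := Measure.isProbabilityMeasure_map hq.aemeasurable
  have hmap : ∀ a, (μ.map q).real {a} = (μ (q ⁻¹' {a})).toReal := fun a => by
    rw [measureReal_def, Measure.map_apply hq (measurableSet_singleton a)]
  have hle : ∫ x, G x ∂μ ≤ ∑ a, (μ (q ⁻¹' {a})).toReal * Real.log (w a) := by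
    have hint : Integrable (fun a => Real.log (w a)) (μ.map q) := Integrable.of_finite
    calc ∫ x, G x ∂μ ≤ ∫ x, Real.log (w (q x)) ∂μ :=
          integral_mono hG (hint.comp_measurable hq) fun x =>
            (Real.le_log_iff_exp_le ((Real.exp_pos _).trans_le (hGw x))).2 (hGw x)
      _ = ∑ a, (μ (q ⁻¹' {a})).toReal * Real.log (w a) := by
          rw [← integral_map hq.aemeasurable hint.aestronglyMeasurable (f := fun a =>
            Real.log (w a)), integral_fintype hint]
          simp [hmap]
  have hone : ∑ a, (μ (q ⁻¹' {a})).toReal = 1 := by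
    have := sum_measureReal_singleton (μ := μ.map q) Finset.univ
    simpa [hmap] using this
  have hterm : ∀ a, Real.negMulLog (μ (q ⁻¹' {a})).toReal +
      (μ (q ⁻¹' {a})).toReal * Real.log (w a) ≤ w a - (μ (q ⁻¹' {a})).toReal := by
    intro a
    rcases (ENNReal.toReal_nonneg : 0 ≤ (μ (q ⁻¹' {a})).toReal).eq_or_lt with h0 | hpos
    · simp [← h0, hw a]
    · obtain ⟨x, hx⟩ : (q ⁻¹' {a}).Nonempty := by
        by_contra hne
        rw [not_nonempty_iff_eq_empty.1 hne] at hpos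
        simp at hpos
      have hwa : 0 < w a := by
        have := hGw x
        rw [show q x = a from hx] at this
        exact (Real.exp_pos _).trans_le this
      set m := (μ (q ⁻¹' {a})).toReal
      have := Real.log_le_sub_one_of_pos (div_pos hwa hpos)
      rw [Real.log_div hwa.ne' hpos.ne'] at this
      have h2 := mul_le_mul_of_nonneg_left this hpos.le
      rw [mul_sub, mul_sub, mul_div_cancel₀ _ hpos.ne'] at h2
      rw [Real.negMulLog]
      linarith
  have := Finset.sum_le_sum fun a (_ : a ∈ Finset.univ) => hterm a
  rw [Finset.sum_add_distrib, Finset.sum_sub_distrib, hone] at this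
  unfold mapEntropy
  linarith

theorem eventually_unique_label [MetricSpace X] [CompactSpace X] {k : ℕ} [NeZero k]
    {K : Fin k → Set X} (hK : ∀ i, IsClosed (K i))
    (hdisj : ∀ i j, i ≠ j → Disjoint (K i) (K j)) :
    ∀ᶠ ε in 𝓝[>] (0 : ℝ), ∀ y, ∃ j, ∀ i, ∀ x ∈ K i, dist y x ≤ ε → i = j := by
  have h : ∀ i j, ∀ᶠ ε in 𝓝[>] (0 : ℝ), i ≠ j →
      Disjoint (Metric.cthickening ε (K i)) (Metric.cthickening ε (K j)) := by
    intro i j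
    by_cases hij : i = j
    · simp [hij]
    obtain ⟨r, hr, hd⟩ := (hdisj i j hij).exists_cthickenings (hK i).isCompact (hK j)
    filter_upwards [Ioo_mem_nhdsGT hr] with ε hε _
    exact hd.mono (Metric.cthickening_mono hε.2.le _) (Metric.cthickening_mono hε.2.le _)
  filter_upwards [eventually_all.2 fun i => eventually_all.2 (h i)] with ε hε y
  by_cases hy : ∃ j, ∃ x ∈ K j, dist y x ≤ ε
  · obtain ⟨j, x, hx, hyx⟩ := hy
    refine ⟨j, fun i z hz hyz => ?_⟩
    by_contra hij
    exact Set.disjoint_left.1 (hε i j hij) (Metric.mem_cthickening_of_dist_le _ _ _ _ hz hyz)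
      (Metric.mem_cthickening_of_dist_le _ _ _ _ hx hyx)
  · push Not at hy
    exact ⟨0, fun i x hx hyx => absurd hyx (hy i x hx).not_ge⟩

/-- For small `ε`, the value `p x` of a finite partition is predicted by any `ε`-close point `y`
through a Markov kernel `u`, at an average logarithmic cost `-∫ V ≤ 2δ`. -/
theorem exists_prediction_kernel [MetricSpace X] [CompactSpace X] [MeasurableSpace X]
    [BorelSpace X] (μ : Measure X) [IsProbabilityMeasure μ] {k : ℕ} [NeZero k] {p : X → Fin k}
    (hp : Measurable p) {δ : ℝ} (hδ : 0 < δ) :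
    ∃ V : X → ℝ, Integrable V μ ∧ (∀ x, V x ≤ 0) ∧ -(2 * δ) ≤ ∫ x, V x ∂μ ∧
      ∀ᶠ ε in 𝓝[>] (0 : ℝ), ∃ u : X → Fin k → ℝ, (∀ y a, 0 ≤ u y a) ∧ (∀ y, ∑ a, u y a = 1) ∧
        ∀ x y, dist y x ≤ ε → Real.exp (V x) ≤ u y (p x) := by
  classical
  have hk : (0 : ℝ) < k := by exact_mod_cast Nat.pos_of_ne_zero (NeZero.ne k)
  have hk1 : (1 : ℝ) ≤ k := by exact_mod_cast Nat.pos_of_ne_zero (NeZero.ne k)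
  have hexp : Real.exp (-δ) < 1 := by simpa using hδ
  set η : ℝ := 1 - Real.exp (-δ) with hη
  have hη0 : 0 < η := by linarith
  have hη1 : η < 1 := by linarith [Real.exp_pos (-δ)]
  set b : ℝ := Real.log (η / k) with hb
  have hb0 : b ≤ 0 := Real.log_nonpos (by positivity) ((div_le_one hk).2 (by linarith))
  set θ : ℝ := δ / (k * (|b + δ| + 1)) with hθ
  have hθ0 : 0 < θ := by positivity
  have hK : ∀ i, ∃ F ⊆ p ⁻¹' {i}, IsClosed F ∧ μ (p ⁻¹' {i} \ F) < ENNReal.ofReal θ := fun i =>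
    (hp (measurableSet_singleton i)).exists_isClosed_sdiff_lt (measure_ne_top _ _)
      (by simpa using hθ0)
  choose K hKp hKc hKμ using hK
  set D : Set X := (⋃ i, K i)ᶜ with hD
  have hDm : MeasurableSet D := (MeasurableSet.iUnion fun i => (hKc i).measurableSet).compl
  have hDsub : D ⊆ ⋃ i, p ⁻¹' {i} \ K i := fun x hx =>
    mem_iUnion.2 ⟨p x, rfl, fun h => hx (mem_iUnion.2 ⟨_, h⟩)⟩
  have hDμ : μ.real D ≤ k * θ := by
    refine ENNReal.toReal_le_of_le_ofReal (by positivity) ?_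
    calc μ D ≤ ∑ i, μ (p ⁻¹' {i} \ K i) := (measure_mono hDsub).trans (measure_iUnion_fintype_le _ _)
      _ ≤ ∑ _i : Fin k, ENNReal.ofReal θ := Finset.sum_le_sum fun i _ => (hKμ i).le
      _ = ENNReal.ofReal (k * θ) := by
          rw [ENNReal.ofReal_mul hk.le]
          simp
  have hint : Integrable (D.indicator fun _ => b + δ) μ :=
    (integrable_const _).indicator hDm
  refine ⟨fun x => -δ + D.indicator (fun _ => b + δ) x, (integrable_const _).add hint,
    fun x => ?_, ?_, ?_⟩
  · by_cases hx : x ∈ D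
    · simp [hx, hb0]
    · simp [hx, hδ.le]
  · rw [integral_add (integrable_const _) hint, integral_indicator_const _ hDm]
    simp only [integral_const, probReal_univ, smul_eq_mul]
    have h1 : μ.real D * |b + δ| ≤ δ := by
      calc μ.real D * |b + δ| ≤ k * θ * (|b + δ| + 1) :=
            mul_le_mul hDμ (by linarith) (abs_nonneg _) (by positivity)
        _ = δ := by
            rw [hθ]
            field_simp
    have h2 : -(μ.real D * |b + δ|) ≤ μ.real D * (b + δ) := by
      rw [← mul_neg]
      exact mul_le_mul_of_nonneg_left (neg_abs_le _) measureReal_nonneg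
    linarith
  · have hdisj : ∀ i j, i ≠ j → Disjoint (K i) (K j) := fun i j hij =>
      Set.disjoint_left.2 fun x hi hj => hij ((hKp i hi).symm.trans (hKp j hj))
    filter_upwards [eventually_unique_label hKc hdisj] with ε hε
    choose J hJ using hε
    refine ⟨fun y a => η / k + if a = J y then Real.exp (-δ) else 0, fun y a => ?_, fun y => ?_,
      fun x y hxy => ?_⟩
    · positivity
    · rw [Finset.sum_add_distrib]
      simp only [Finset.sum_const, Finset.card_univ, Fintype.card_fin, nsmul_eq_mul,
        Finset.sum_ite_eq', Finset.mem_univ, if_true]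
      rw [mul_div_cancel₀ _ hk.ne']
      linarith
    · by_cases hx : x ∈ D
      · have : Real.exp b = η / k := Real.exp_log (by positivity)
        simp only [hx, indicator_of_mem, neg_add_cancel_comm_assoc, this]
        split_ifs <;> linarith [Real.exp_pos (-δ)]
      · obtain ⟨i, hi⟩ := mem_iUnion.1 (not_not.1 hx)
        have hpx : p x = J y := (show p x = i from hKp i hi).trans (hJ y i x hi hxy)
        simp only [hx, not_false_eq_true, indicator_of_notMem, add_zero, hpx, if_true]
        linarith [div_pos hη0 hk]

theorem exists_spanning_sum_lt [MetricSpace X] {f : X → X} {φ ψ : X → ℝ} {ε β : ℝ}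
    (h : limsup (fun T : ℝ => ENNReal.log (inducedQ f ψ φ T ε) * ((T⁻¹ : ℝ) : EReal)) atTop < β) :
    ∀ᶠ T : ℝ in atTop, ∃ F : ℕ → Finset X,
      (∀ n ∈ inducedST f ψ T, IsSpanningSetOf f n ε (inducedXn f ψ T n) (F n)) ∧
      ∑' n : inducedST f ψ T, ∑ x ∈ F n, ENNReal.ofReal (Real.exp (birkhoff f φ n x)) <
        ENNReal.ofReal (Real.exp (β * T)) := by
  filter_upwards [eventually_lt_of_limsup_lt h, eventually_gt_atTop 0] with T hT hT0
  have hlog : ENNReal.log (inducedQ f ψ φ T ε) < ((β * T : ℝ) : EReal) := by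
    rw [EReal.coe_mul]
    rw [← EReal.div_lt_iff (by exact_mod_cast hT0) (EReal.coe_ne_top T)]
    exact hT
  have hQ : inducedQ f ψ φ T ε < ENNReal.ofReal (Real.exp (β * T)) := by
    rw [← EReal.exp_coe, ← ENNReal.exp_log (inducedQ f ψ φ T ε)]
    exact EReal.exp_strictMono hlog
  unfold inducedQ at hQ
  obtain ⟨F, hF⟩ := iInf_lt_iff.1 hQ
  obtain ⟨hF1, hF2⟩ := iInf_lt_iff.1 hF
  exact ⟨F, hF1, hF2⟩

theorem exists_mem_inducedXn {f : X → X} {ψ : X → ℝ} {c : ℝ} (hc : 0 < c) (hψ : ∀ x, c ≤ ψ x)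
    {T : ℝ} (hT : 0 ≤ T) (x : X) : ∃ n, x ∈ inducedXn f ψ T n := by
  classical
  have hex : ∃ n, T < birkhoff f ψ (n + 1) x := by
    obtain ⟨n, hn⟩ := exists_nat_gt (T / c)
    refine ⟨n, ?_⟩
    have h1 := nsmul_le_birkhoff (f := f) hψ (n + 1) x
    have h2 := (div_lt_iff₀ hc).1 hn
    push_cast at h1
    linarith
  refine ⟨Nat.find hex, ?_, Nat.find_spec hex⟩
  rcases hn : Nat.find hex with _ | m
  · simpa [birkhoff] using hT
  · exact not_lt.1 (Nat.find_min hex (m := m) (by omega))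

/-- Spanning sets at a single large level `T` give a finite family of weighted blocks that start
every orbit. -/
theorem exists_blocks [MetricSpace X] {f : X → X} {φ ψ : X → ℝ} {ε β δ c M : ℝ} (hδ : 0 < δ)
    (hc : 0 < c) (hψ : ∀ x, c ≤ ψ x ∧ ψ x ≤ M) (hM : 0 < M)
    (hφ : ∀ x y, dist x y ≤ ε → |φ x - φ y| ≤ δ)
    (h : limsup (fun T : ℝ => ENNReal.log (inducedQ f ψ φ T ε) * ((T⁻¹ : ℝ) : EReal)) atTop < β) :
    ∃ (L : ℕ) (s : Finset (Σ _ : ℕ, X)) (E : (Σ _ : ℕ, X) → ℝ),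
      (∀ i ∈ s, 1 ≤ i.1 ∧ i.1 ≤ L) ∧ (∀ i, 0 ≤ E i) ∧ ∑ i ∈ s, E i ≤ 1 ∧
      ∀ x, ∃ i ∈ s, (∀ j < i.1, dist (f^[j] i.2) (f^[j] x) ≤ ε) ∧
        Real.exp (birkhoff f (fun x => φ x - β * ψ x - 2 * δ) i.1 x) ≤ E i := by
  obtain ⟨T, ⟨F, hF, hsum⟩, hT⟩ := ((exists_spanning_sum_lt h).and
    (eventually_ge_atTop (M * (1 + |β| * M / δ)))).exists
  have hMT : M ≤ T := le_trans (le_mul_of_one_le_right hM.le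
    (by linarith [show 0 ≤ |β| * M / δ by positivity])) hT
  have hL : ∀ n ∈ inducedST f ψ T, 1 ≤ n ∧ n ≤ ⌊T / c⌋₊ := by
    rintro n ⟨x, hx1, hx2⟩
    constructor
    · rw [Nat.one_le_iff_ne_zero]
      rintro rfl
      have := (hψ x).2
      simp [birkhoff] at hx2
      linarith
    · apply Nat.le_floor
      rw [le_div_iff₀ hc]
      exact (nsmul_le_birkhoff (fun x => (hψ x).1) n x).trans hx1
  have hfin : (inducedST f ψ T).Finite :=
    (Set.finite_Iic ⌊T / c⌋₊).subset fun n hn => (hL n hn).2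
  refine ⟨⌊T / c⌋₊, hfin.toFinset.sigma F, fun i => Real.exp (birkhoff f φ i.1 i.2 - β * T),
    fun i hi => hL _ (hfin.mem_toFinset.1 (Finset.mem_sigma.1 hi).1),
    fun i => (Real.exp_pos _).le, ?_, fun x => ?_⟩
  · have h1 := Finset.tsum_subtype' hfin.toFinset
      (fun n => ∑ x ∈ F n, ENNReal.ofReal (Real.exp (birkhoff f φ n x)))
    rw [hfin.coe_toFinset] at h1
    rw [h1] at hsum
    simp_rw [← ENNReal.ofReal_sum_of_nonneg fun x (_ : x ∈ F _) => (Real.exp_pos _).le] at hsum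
    rw [← ENNReal.ofReal_sum_of_nonneg fun n _ => Finset.sum_nonneg fun x _ =>
      (Real.exp_pos _).le, ENNReal.ofReal_lt_ofReal_iff (Real.exp_pos _)] at hsum
    rw [Finset.sum_sigma]
    simp_rw [Real.exp_sub, ← Finset.sum_div]
    exact (div_le_one (Real.exp_pos _)).2 hsum.le
  · obtain ⟨n, hn⟩ := exists_mem_inducedXn (f := f) hc (fun x => (hψ x).1) (hM.le.trans hMT) x
    have hnS : n ∈ inducedST f ψ T := ⟨x, hn⟩
    obtain ⟨z, hz, hzx⟩ := hF n hnS x hn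
    refine ⟨⟨n, z⟩, Finset.mem_sigma.2 ⟨hfin.mem_toFinset.2 hnS, hz⟩, hzx, ?_⟩
    obtain ⟨hx1, hx2⟩ := hn
    have hsucc : birkhoff f ψ (n + 1) x = birkhoff f ψ n x + ψ (f^[n] x) :=
      birkhoffSum_succ f ψ n x
    have hφn : birkhoff f φ n x - birkhoff f φ n z ≤ n * δ := by
      unfold birkhoff
      rw [← Finset.sum_sub_distrib]
      refine (Finset.sum_le_card_nsmul _ _ δ fun i hi => ?_).trans (by simp)
      have := hφ _ _ (hzx i (Finset.mem_range.1 hi))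
      rw [abs_sub_comm] at this
      exact (le_abs_self _).trans this
    have hdef : |β * (T - birkhoff f ψ n x)| ≤ n * δ := by
      have h1 : |T - birkhoff f ψ n x| ≤ M := by
        rw [abs_of_nonneg (by linarith)]
        linarith [(hψ (f^[n] x)).2]
      have h2 : M * (1 + |β| * M / δ) < M * (1 + n) := by
        have := birkhoff_le_nsmul (f := f) (fun x => (hψ x).2) (n + 1) x
        push_cast at this
        linarith
      have h3 : |β| * M / δ < n := by linarith [lt_of_mul_lt_mul_left h2 hM.le]
      rw [div_lt_iff₀ hδ] at h3
      rw [abs_mul]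
      exact (mul_le_mul_of_nonneg_left h1 (abs_nonneg _)).trans h3.le
    have hsplit : birkhoff f (fun x => φ x - β * ψ x - 2 * δ) n x =
        birkhoff f φ n x - β * birkhoff f ψ n x - n * (2 * δ) := by
      simp [birkhoff, Finset.sum_sub_distrib, Finset.mul_sum]
    rw [Real.exp_le_exp, hsplit]
    have := neg_abs_le (β * (T - birkhoff f ψ n x))
    have := le_abs_self (β * (T - birkhoff f ψ n x))
    linarith

theorem measurePreserving_of_mem_invMeasures [MetricSpace X] [MeasurableSpace X] [BorelSpace X]
    {f : X → X} (hf : Continuous f) {μ : Measure X} (hμ : μ ∈ invMeasures f) :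
    MeasurePreserving f μ μ :=
  ⟨hf.measurable, Measure.ext fun B hB => by
    rw [Measure.map_apply hf.measurable hB, hμ.2 B hB]⟩

theorem integral_birkhoff [MeasurableSpace X] {f : X → X} {μ : Measure X}
    (hf : MeasurePreserving f μ μ) {G : X → ℝ} (hG : Integrable G μ) (n : ℕ) :
    Integrable (birkhoff f G n) μ ∧ ∫ x, birkhoff f G n x ∂μ = n * ∫ x, G x ∂μ := by
  have hi : ∀ i, Integrable (fun x => G (f^[i] x)) μ := fun i =>
    (hf.iterate i).integrable_comp_of_integrable hG
  refine ⟨integrable_finsetSum _ fun i _ => hi i, ?_⟩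
  unfold birkhoff
  rw [integral_finsetSum _ fun i _ => hi i]
  have : ∀ i, ∫ x, G (f^[i] x) ∂μ = ∫ x, G x ∂μ := fun i => by
    have hm := (hf.iterate i).map_eq
    conv_rhs => rw [← hm]
    rw [integral_map (hf.iterate i).aemeasurable (by rw [hm]; exact hG.aestronglyMeasurable)]
  simp [this]

theorem integrable_of_continuous [MetricSpace X] [CompactSpace X] [MeasurableSpace X]
    [BorelSpace X] {g : X → ℝ} (hg : Continuous g) (μ : Measure X) [IsFiniteMeasure μ] :
    Integrable g μ :=
  hg.integrable_of_hasCompactSupport (HasCompactSupport.of_compactSpace g)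

theorem eventually_dist_le_imp_abs_sub_le [MetricSpace X] [CompactSpace X] {φ : X → ℝ}
    (hφ : Continuous φ) {δ : ℝ} (hδ : 0 < δ) :
    ∀ᶠ ε in 𝓝[>] (0 : ℝ), ∀ x y, dist x y ≤ ε → |φ x - φ y| ≤ δ := by
  obtain ⟨r, hr, h⟩ := Metric.uniformContinuous_iff.1
    (CompactSpace.uniformContinuous_of_continuous hφ) δ hδ
  filter_upwards [Ioo_mem_nhdsGT hr] with ε hε x y hxy
  exact (h (hxy.trans_lt hε.2)).le

theorem exists_pos_bounds [MetricSpace X] [CompactSpace X] [Nonempty X] {ψ : X → ℝ}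
    (hψ : Continuous ψ) (hpos : ∀ x, 0 < ψ x) :
    ∃ c M : ℝ, 0 < c ∧ 0 < M ∧ ∀ x, c ≤ ψ x ∧ ψ x ≤ M := by
  obtain ⟨a, -, ha⟩ := isCompact_univ.exists_isMinOn univ_nonempty hψ.continuousOn
  obtain ⟨b, -, hb⟩ := isCompact_univ.exists_isMaxOn univ_nonempty hψ.continuousOn
  exact ⟨ψ a, ψ b, hpos a, hpos b, fun x => ⟨ha (mem_univ x), hb (mem_univ x)⟩⟩

theorem liminf_mapEntropy_le [MetricSpace X] [CompactSpace X] [Nonempty X] [MeasurableSpace X]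
    [BorelSpace X] {f : X → X} (hf : Continuous f) {φ ψ : X → ℝ} (hφ : Continuous φ)
    (hψ : Continuous ψ) (hpos : ∀ x, 0 < ψ x) {μ : Measure X} (hμ : μ ∈ invMeasures f) {β : ℝ}
    (hβ : inducedPressure f ψ φ < β) {k : ℕ} {p : X → Fin k} (hp : Measurable p) {δ : ℝ}
    (hδ : 0 < δ) :
    liminf (fun n : ℕ =>
      (((n : ℝ)⁻¹ * mapEntropy μ (fun x (i : Fin n) => p (f^[i] x)) : ℝ) : EReal)) atTop ≤
      ((β * ∫ x, ψ x ∂μ - ∫ x, φ x ∂μ + 4 * δ : ℝ) : EReal) := by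
  have hprob : IsProbabilityMeasure μ := hμ.1
  have hpres := measurePreserving_of_mem_invMeasures hf hμ
  have : NeZero k := ⟨by rintro rfl; exact (p (Classical.arbitrary X)).elim0⟩
  obtain ⟨c, M, hc, hM, hψb⟩ := exists_pos_bounds hψ hpos
  obtain ⟨V, hVi, hV0, hVint, hVε⟩ := exists_prediction_kernel μ hp hδ
  obtain ⟨ε, ⟨⟨u, hu0, hu1, huV⟩, hε⟩, hlim⟩ := ((hVε.and
    (eventually_dist_le_imp_abs_sub_le hφ hδ)).and (eventually_lt_of_limsup_lt hβ)).exists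
  obtain ⟨L, s, E, hL, hE0, hE1, hcov⟩ := exists_blocks hδ hc hψb hM hε hlim
  set g : X → ℝ := fun x => φ x - β * ψ x - 2 * δ with hg
  have hgc : Continuous g := by fun_prop
  have hgi : Integrable g μ := integrable_of_continuous hgc μ
  set G : X → ℝ := fun x => g x + V x with hGdef
  have hGi : Integrable G μ := hgi.add hVi
  obtain ⟨C, hC⟩ : ∃ C, ∀ x, g x ≤ C := by
    obtain ⟨b, -, hb⟩ := isCompact_univ.exists_isMaxOn univ_nonempty hgc.continuousOn
    exact ⟨g b, fun x => hb (mem_univ x)⟩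
  have hsplit : ∀ n x, birkhoff f G n x = birkhoff f g n x + birkhoff f V n x := fun n x =>
    Finset.sum_add_distrib
  obtain ⟨a, ha, hw⟩ := exists_word_weights f p s (fun i => i.1)
    (fun i l => E i * orbitWeight f u i.2 l) L hL
    (fun i _ l => mul_nonneg (hE0 i) (orbitWeight_nonneg hu0 l _))
    (by simpa only [← Finset.mul_sum, sum_orbitWeight hu1, mul_one] using hE1)
    G (max C 0) (le_max_right _ _)
    (fun x => (add_le_of_nonpos_right (hV0 x)).trans ((hC x).trans (le_max_left _ _)))
    (fun x => by
      obtain ⟨i, hi, hix, hiE⟩ := hcov x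
      refine ⟨i, hi, ?_⟩
      rw [hsplit, Real.exp_add]
      exact mul_le_mul hiE (exp_birkhoff_le_orbitWeight _ _ _ fun j hj => huV _ _ (hix j hj))
        (Real.exp_pos _).le (hE0 i))
  have hH : ∀ N : ℕ, mapEntropy μ (fun x (i : Fin N) => p (f^[i] x)) ≤
      -Real.log a + N * (-∫ x, G x ∂μ) := by
    intro N
    obtain ⟨w, hw0, hw1, hwG⟩ := hw N
    obtain ⟨hbi, hbint⟩ := integral_birkhoff hpres hGi N
    have hmeas : Measurable fun x (i : Fin N) => p (f^[i] x) :=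
      measurable_pi_lambda _ fun i => hp.comp (hf.iterate i).measurable
    have := mapEntropy_le_neg_integral μ _ hmeas (fun b => w (List.ofFn b)) (fun b => hw0 _) hw1
      (fun x => Real.log a + birkhoff f G N x) ((integrable_const _).add hbi) fun x => by
        rw [Real.exp_add, Real.exp_log ha]
        exact hwG x
    rw [integral_add (integrable_const _) hbi, hbint] at this
    simp at this
    linarith
  have hGint : -∫ x, G x ∂μ ≤ β * ∫ x, ψ x ∂μ - ∫ x, φ x ∂μ + 4 * δ := by
    have h1 : Integrable φ μ := integrable_of_continuous hφ μ
    have h2 : Integrable ψ μ := integrable_of_continuous hψ μ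
    have h3 : ∫ x, g x ∂μ = ∫ x, φ x ∂μ - β * ∫ x, ψ x ∂μ - 2 * δ := by
      have h4 : Integrable (fun x => φ x - β * ψ x) μ := h1.sub (h2.const_mul β)
      show ∫ x, (φ x - β * ψ x - 2 * δ) ∂μ = _
      rw [integral_sub h4 (integrable_const _), integral_sub h1 (h2.const_mul β),
        integral_const_mul]
      simp
    rw [hGdef, integral_add hgi hVi, h3]
    linarith
  have htend : Tendsto (fun n : ℕ => (((n : ℝ)⁻¹ * -Real.log a - ∫ x, G x ∂μ : ℝ) : EReal)) atTop
      (𝓝 ((-∫ x, G x ∂μ : ℝ) : EReal)) := by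
    refine EReal.tendsto_coe.2 ?_
    have := (tendsto_inv_atTop_nhds_zero_nat (𝕜 := ℝ)).mul_const (-Real.log a)
    simpa [sub_eq_add_neg] using this.add_const (-∫ x, G x ∂μ)
  refine le_trans ?_ (EReal.coe_le_coe_iff.2 hGint)
  rw [← htend.liminf_eq]
  refine liminf_le_liminf ?_
  filter_upwards [eventually_gt_atTop 0] with n hn
  have hn' : (0 : ℝ) < n := by exact_mod_cast hn
  rw [EReal.coe_le_coe_iff]
  calc (n : ℝ)⁻¹ * mapEntropy μ (fun x (i : Fin n) => p (f^[i] x))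
      ≤ (n : ℝ)⁻¹ * (-Real.log a + n * (-∫ x, G x ∂μ)) := by gcongr; exact hH n
    _ = (n : ℝ)⁻¹ * -Real.log a - ∫ x, G x ∂μ := by
        field_simp
        ring

theorem measEntropy_le_of_inducedPressure_lt [MetricSpace X] [CompactSpace X] [Nonempty X]
    [MeasurableSpace X] [BorelSpace X] {f : X → X} (hf : Continuous f) {φ ψ : X → ℝ}
    (hφ : Continuous φ) (hψ : Continuous ψ) (hpos : ∀ x, 0 < ψ x) {μ : Measure X}
    (hμ : μ ∈ invMeasures f) {β : ℝ} (hβ : inducedPressure f ψ φ < β) :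
    measEntropy f μ ≤ ((β * ∫ x, ψ x ∂μ - ∫ x, φ x ∂μ : ℝ) : EReal) := by
  refine iSup_le fun k => iSup_le fun p => iSup_le fun hp => ?_
  rw [← EReal.le_of_forall_lt_iff_le]
  intro z hz
  rw [EReal.coe_lt_coe_iff] at hz
  have := liminf_mapEntropy_le hf hφ hψ hpos hμ hβ hp (δ := (z - (β * ∫ x, ψ x ∂μ -
    ∫ x, φ x ∂μ)) / 4) (by linarith)
  convert this using 2
  ring

theorem integral_pos_of_mem_invMeasures [MetricSpace X] [CompactSpace X] [Nonempty X]
    [MeasurableSpace X] [BorelSpace X] {f : X → X} {ψ : X → ℝ} (hψ : Continuous ψ)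
    (hpos : ∀ x, 0 < ψ x) {μ : Measure X} (hμ : μ ∈ invMeasures f) : 0 < ∫ x, ψ x ∂μ := by
  have : IsProbabilityMeasure μ := hμ.1
  obtain ⟨c, M, hc, -, hb⟩ := exists_pos_bounds hψ hpos
  have h := integral_mono (integrable_const c) (integrable_of_continuous hψ μ) fun x => (hb x).1
  simp at h
  linarith

/-- The lower half of the variational principle for the induced pressure. -/
theorem le_inducedPressure [MetricSpace X] [CompactSpace X] [Nonempty X]
    [MeasurableSpace X] [BorelSpace X] {f : X → X} (hf : Continuous f) {φ ψ : X → ℝ}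
    (hφ : Continuous φ) (hψ : Continuous ψ) (hpos : ∀ x, 0 < ψ x) {μ : Measure X}
    (hμ : μ ∈ invMeasures f) :
    (measEntropy f μ + ((∫ x, φ x ∂μ : ℝ) : EReal)) / ((∫ x, ψ x ∂μ : ℝ) : EReal) ≤
      inducedPressure f ψ φ := by
  rw [← EReal.le_of_forall_lt_iff_le]
  intro z hz
  have hI := integral_pos_of_mem_invMeasures hψ hpos hμ
  rw [EReal.div_le_iff_le_mul (by exact_mod_cast hI) (EReal.coe_ne_top _)]
  calc measEntropy f μ + ((∫ x, φ x ∂μ : ℝ) : EReal)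
      ≤ ((z * ∫ x, ψ x ∂μ - ∫ x, φ x ∂μ : ℝ) : EReal) + ((∫ x, φ x ∂μ : ℝ) : EReal) := by
        gcongr
        exact measEntropy_le_of_inducedPressure_lt hf hφ hψ hpos hμ hz
    _ = ((∫ x, ψ x ∂μ : ℝ) : EReal) * z := by
        rw [← EReal.coe_add, ← EReal.coe_mul]
        congr 1
        ring

theorem measEntropy_nonneg [MetricSpace X] [MeasurableSpace X] [BorelSpace X] (f : X → X)
    (μ : Measure X) [IsProbabilityMeasure μ] : 0 ≤ measEntropy f μ := by
  refine le_trans ?_ (le_iSup_of_le 1 (le_iSup_of_le (fun _ => 0) (le_iSup_of_le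
    measurable_const le_rfl)))
  refine le_liminf_of_le (by isBoundedDefault) (Eventually.of_forall fun n => ?_)
  refine EReal.coe_nonneg.2 (mul_nonneg (by positivity) (Finset.sum_nonneg fun a _ => ?_))
  exact Real.negMulLog_nonneg ENNReal.toReal_nonneg measureReal_le_one

theorem exists_measEntropy_eq_coe [MetricSpace X] [CompactSpace X] [Nonempty X]
    [MeasurableSpace X] [BorelSpace X] {f : X → X} (hf : Continuous f) (htop : topEntropy f < ⊤)
    {μ : Measure X} (hμ : μ ∈ invMeasures f) : ∃ r : ℝ, measEntropy f μ = r := by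
  have : IsProbabilityMeasure μ := hμ.1
  obtain ⟨β, hβ, -⟩ := EReal.lt_iff_exists_real_btwn.1 htop
  have h := measEntropy_le_of_inducedPressure_lt hf continuous_const continuous_const
    (fun _ => one_pos) hμ hβ
  have hbot : measEntropy f μ ≠ ⊥ := ((EReal.bot_lt_zero).trans_le (measEntropy_nonneg f μ)).ne'
  exact ⟨_, (EReal.coe_toReal (h.trans_lt (EReal.coe_lt_top _)).ne hbot).symm⟩

theorem bddAbove_ratio [MetricSpace X] [CompactSpace X] [Nonempty X] [MeasurableSpace X]
    [BorelSpace X] {f : X → X} {φ ψ : X → ℝ} (hφ : Continuous φ) (hψ : Continuous ψ)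
    (hpos : ∀ x, 0 < ψ x) :
    BddAbove (range fun ν : invMeasures f =>
      (∫ x, φ x ∂(ν : Measure X)) / (∫ x, ψ x ∂(ν : Measure X))) := by
  have hcont : Continuous fun x => φ x / ψ x := hφ.div hψ fun x => (hpos x).ne'
  obtain ⟨b, -, hb⟩ := isCompact_univ.exists_isMaxOn univ_nonempty hcont.continuousOn
  refine ⟨φ b / ψ b, ?_⟩
  rintro _ ⟨⟨ν, hν⟩, rfl⟩
  have : IsProbabilityMeasure ν := hν.1
  rw [div_le_iff₀ (integral_pos_of_mem_invMeasures hψ hpos hν), ← integral_const_mul]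
  refine integral_mono (integrable_of_continuous hφ ν)
    ((integrable_of_continuous hψ ν).const_mul _) fun x => ?_
  exact (div_le_iff₀ (hpos x)).1 (hb (mem_univ x))

theorem coe_add_mul_div (r β a I : ℝ) :
    ((r : EReal) + ((β * a : ℝ) : EReal)) / ((I : ℝ) : EReal) =
      ((r / I + β * (a / I) : ℝ) : EReal) := by
  rw [← EReal.coe_add, ← EReal.coe_div]
  congr 1
  ring

/-- `φ` freezes at `β₀` (some `μ ∈ M(X,f)` is an equilibrium state of
`P_ψ(βφ)` for all `β ≥ β₀`) iff (1) `P_ψ(βφ) = β·Max^ψ(φ) + h_∞^ψ(φ)` for all `β ≥ β₀`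
and (2) `P_ψ(β₁φ)` has an equilibrium state for some `β₁ > β₀`. -/
theorem freezes_iff
    {X : Type*} [MetricSpace X] [CompactSpace X] [Nonempty X]
    [MeasurableSpace X] [BorelSpace X]
    (f : X → X) (hf : Continuous f)
    (φ ψ : X → ℝ) (hφ : Continuous φ) (hψ : Continuous ψ) (hψpos : ∀ x, 0 < ψ x)
    (htop : topEntropy f < ⊤) (β₀ : ℝ) :
    (∃ μ ∈ invMeasures f, ∀ β : ℝ, β₀ ≤ β →
        μ ∈ equilibriumStates f ψ (fun x => β * φ x)) ↔
      ((∀ β : ℝ, β₀ ≤ β →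
          inducedPressure f ψ (fun x => β * φ x) =
            (((β * maxRatio f ψ φ) : ℝ) : EReal) + hInfty f ψ φ) ∧
        ∃ β₁ : ℝ, β₀ < β₁ ∧
          (equilibriumStates f ψ (fun x => β₁ * φ x)).Nonempty) := by
  have hform : ∀ ν ∈ invMeasures f, ∀ r : ℝ, measEntropy f ν = r → ∀ β : ℝ,
      (measEntropy f ν + ((∫ x, β * φ x ∂ν : ℝ) : EReal)) / ((∫ x, ψ x ∂ν : ℝ) : EReal) =
        ((r / (∫ x, ψ x ∂ν) + β * ((∫ x, φ x ∂ν) / ∫ x, ψ x ∂ν) : ℝ) : EReal) := by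
    intro ν _ r hr β
    rw [hr, integral_const_mul, coe_add_mul_div]
  have hvar : ∀ ν ∈ invMeasures f, ∀ r : ℝ, measEntropy f ν = r → ∀ β : ℝ,
      ((r / (∫ x, ψ x ∂ν) + β * ((∫ x, φ x ∂ν) / ∫ x, ψ x ∂ν) : ℝ) : EReal) ≤
        inducedPressure f ψ (fun x => β * φ x) := by
    intro ν hν r hr β
    rw [← hform ν hν r hr β]
    exact le_inducedPressure hf (by fun_prop) hψ hψpos hν
  have hbdd := bddAbove_ratio (f := f) hφ hψ hψpos
  constructor
  · rintro ⟨μ, hμ, heq⟩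
    obtain ⟨r, hr⟩ := exists_measEntropy_eq_coe hf htop hμ
    have hP : ∀ β : ℝ, β₀ ≤ β → inducedPressure f ψ (fun x => β * φ x) =
        ((r / (∫ x, ψ x ∂μ) + β * ((∫ x, φ x ∂μ) / ∫ x, ψ x ∂μ) : ℝ) : EReal) := fun β hβ =>
      (heq β hβ).2.trans (hform μ hμ r hr β)
    have hdom : ∀ ν ∈ invMeasures f, ∀ t : ℝ, measEntropy f ν = t → ∀ β : ℝ, β₀ ≤ β →
        t / (∫ x, ψ x ∂ν) + β * ((∫ x, φ x ∂ν) / ∫ x, ψ x ∂ν) ≤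
          r / (∫ x, ψ x ∂μ) + β * ((∫ x, φ x ∂μ) / ∫ x, ψ x ∂μ) := by
      intro ν hν t ht β hβ
      have := hvar ν hν t ht β
      rwa [hP β hβ, EReal.coe_le_coe_iff] at this
    have hmax : (∫ x, φ x ∂μ) / ∫ x, ψ x ∂μ = maxRatio f ψ φ := by
      refine le_antisymm (le_ciSup hbdd ⟨μ, hμ⟩) ?_
      have : Nonempty (invMeasures f) := ⟨⟨μ, hμ⟩⟩
      refine ciSup_le fun ⟨ν, hν⟩ => ?_
      obtain ⟨t, ht⟩ := exists_measEntropy_eq_coe hf htop hν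
      by_contra! hlt
      have h := hdom ν hν t ht
      dsimp only at hlt
      set a := t / ∫ x, ψ x ∂ν
      set b := (∫ x, φ x ∂ν) / ∫ x, ψ x ∂ν
      set a' := r / ∫ x, ψ x ∂μ
      set b' := (∫ x, φ x ∂μ) / ∫ x, ψ x ∂μ
      have h1 := h (max β₀ ((a' - a + 1) / (b - b'))) (le_max_left _ _)
      have h2 := (div_le_iff₀ (sub_pos.2 hlt)).1
        (le_max_right β₀ ((a' - a + 1) / (b - b')))
      linarith
    have hinf : hInfty f ψ φ = ((r / ∫ x, ψ x ∂μ : ℝ) : EReal) := by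
      refine le_antisymm (iSup_le fun ⟨ν, hν, hνmax⟩ => ?_) ?_
      · obtain ⟨t, ht⟩ := exists_measEntropy_eq_coe hf htop hν
        have h := hdom ν hν t ht β₀ le_rfl
        rw [hνmax, hmax] at h
        dsimp only
        rw [ht, ← EReal.coe_div, EReal.coe_le_coe_iff]
        linarith
      · refine le_iSup_of_le ⟨μ, hμ, hmax⟩ ?_
        dsimp only
        rw [hr, EReal.coe_div]
    refine ⟨fun β hβ => ?_, β₀ + 1, by linarith, μ, heq _ (by linarith)⟩
    rw [hP β hβ, hinf, ← EReal.coe_add, hmax, add_comm]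
  · rintro ⟨hP, β₁, hβ₁, μ, hμ, heq⟩
    obtain ⟨r, hr⟩ := exists_measEntropy_eq_coe hf htop hμ
    rw [hform μ hμ r hr, hP β₁ hβ₁.le] at heq
    obtain ⟨h, hh⟩ : ∃ h : ℝ, hInfty f ψ φ = h := by
      induction hH : hInfty f ψ φ with
      | bot => rw [hH, EReal.add_bot] at heq; exact absurd heq.symm (EReal.coe_ne_bot _)
      | top => rw [hH, EReal.coe_add_top] at heq; exact absurd heq.symm (EReal.coe_ne_top _)
      | coe h => exact ⟨h, rfl⟩
    have hP₀ := hvar μ hμ r hr β₀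
    rw [hP β₀ le_rfl, hh, ← EReal.coe_add, EReal.coe_le_coe_iff] at hP₀
    rw [hh, ← EReal.coe_add, EReal.coe_eq_coe_iff] at heq
    have hle : (∫ x, φ x ∂μ) / ∫ x, ψ x ∂μ ≤ maxRatio f ψ φ := le_ciSup hbdd ⟨μ, hμ⟩
    have hmax : (∫ x, φ x ∂μ) / ∫ x, ψ x ∂μ = maxRatio f ψ φ := by
      refine le_antisymm hle (le_of_mul_le_mul_left ?_ (sub_pos.2 hβ₁))
      linarith
    refine ⟨μ, hμ, fun β hβ => ⟨hμ, ?_⟩⟩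
    rw [hform μ hμ r hr, hP β hβ, hh, ← EReal.coe_add, EReal.coe_eq_coe_iff]
    rw [hmax] at heq ⊢
    linarith
end

section
/- Let (X,d) be a compact metric space, f : X → X continuous, ψ ∈ C(X,ℝ) with ψ > 0, Φ ∈ C(X,ℝ)^d, and F : ℝ^d → ℝ continuous. Set Ψ(x) = (Φ(x), ψ(x)) ∈ C(X,ℝ)^{d+1} and, for β ∈ ℝ, define G_β : ℝ^{d+1} → ℝ by G_β(a,b) = F(a) − βb for a ∈ ℝ^d, b ∈ ℝ. If either (1) (f,Ψ) has an abundance of ergodic measures, or (2) F is convex, then P^F_ψ(Φ) = inf{β ∈ ℝ : P^{G_β}(Ψ) ≤ 0} = sup{β ∈ ℝ : P^{G_β}(Ψ) ≥ 0}. -/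
open Filter Set Topology MeasureTheory ENNReal

variable {X : Type*}

section NL
variable [MetricSpace X]

/-- The `d`-dimensional Birkhoff sum `S_nΦ` of `Φ ∈ C(X,ℝ)^d`. -/
def birkhoffVec (f : X → X) {d : ℕ} (Φ : X → Fin d → ℝ) (n : ℕ) (x : X) : Fin d → ℝ :=
  fun i => birkhoff f (fun y => Φ y i) n x

/-- The nonlinear weight `exp(n F(S_nΦ(x)/n))`. -/
noncomputable def nlWeight (f : X → X) {d : ℕ} (F : (Fin d → ℝ) → ℝ) (Φ : X → Fin d → ℝ)
    (n : ℕ) (x : X) : ℝ≥0∞ :=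
  ENNReal.ofReal (Real.exp (n * F (fun i => birkhoffVec f Φ n x i / n)))

/-- `Q^F_{ψ,T}(f,Φ,ε)`: infimum over families of `(n,ε)`-spanning sets of the `X_n`,
`n ∈ S_T`, of `∑_{n ∈ S_T} ∑_{x ∈ F_n} exp(n F(S_nΦ(x)/n))`. -/
noncomputable def nlInducedQ (f : X → X) {d : ℕ} (ψ : X → ℝ) (F : (Fin d → ℝ) → ℝ)
    (Φ : X → Fin d → ℝ) (T ε : ℝ) : ℝ≥0∞ :=
  ⨅ (C : ℕ → Finset X) (_ : ∀ n ∈ inducedST f ψ T,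
      IsSpanningSetOf f n ε (inducedXn f ψ T n) (C n)),
    ∑' n : inducedST f ψ T, ∑ x ∈ C n, nlWeight f F Φ n x

/-- The nonlinear ψ-induced topological pressure
`P^F_ψ(Φ) = lim_{ε→0⁺} limsup_{T→∞} (1/T) log Q^F_{ψ,T}(f,Φ,ε)` (limit as `ε → 0⁺`
realized as a `limsup` along `𝓝[>] 0`). -/
noncomputable def nlInducedPressure (f : X → X) {d : ℕ} (ψ : X → ℝ) (F : (Fin d → ℝ) → ℝ)
    (Φ : X → Fin d → ℝ) : EReal :=
  limsup (fun ε : ℝ =>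
    limsup (fun T : ℝ => ENNReal.log (nlInducedQ f ψ F Φ T ε) * ((T⁻¹ : ℝ) : EReal)) atTop)
    (𝓝[>] (0 : ℝ))

end NL
section Stmt19
variable [MetricSpace X]

/-- The (non-induced) nonlinear topological pressure
`P^F(Φ) = lim_{ε→0} limsup_{n→∞} (1/n) log sup_E ∑_{x∈E} exp(n F(S_nΦ(x)/n))`,
the supremum over `(n,ε)`-separated sets `E` of `X` (limit as `ε → 0⁺` realized as a
`limsup` along `𝓝[>] 0`). -/
noncomputable def nlPressure (f : X → X) {d : ℕ} (F : (Fin d → ℝ) → ℝ)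
    (Φ : X → Fin d → ℝ) : EReal :=
  limsup (fun ε : ℝ =>
    limsup (fun n : ℕ =>
      ENNReal.log (⨆ (E : Finset X) (_ : IsSeparatedSetOf f n ε Set.univ E),
          ∑ x ∈ E, nlWeight f F Φ n x) * (((n : ℝ)⁻¹ : ℝ) : EReal)) atTop)
    (𝓝[>] (0 : ℝ))

end Stmt19

section Abundance
variable [MetricSpace X] [MeasurableSpace X] [BorelSpace X]

/-- `(f,Φ)` has an abundance of ergodic measures: for every `μ ∈ M(X,f)`, every
`h < h_μ(f)` and every `ε > 0` there is an ergodic `ν ∈ M(X,f)` with `h_ν(f) > h` and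
`|∫φ_i dν − ∫φ_i dμ| < ε` for every component `φ_i` of `Φ`. -/
def HasAbundanceOfErgodicMeasures (f : X → X) {d : ℕ} (Φ : X → Fin d → ℝ) : Prop :=
  ∀ μ ∈ invMeasures f, ∀ h : ℝ, (h : EReal) < measEntropy f μ → ∀ ε : ℝ, 0 < ε →
    ∃ ν ∈ invMeasures f, Ergodic f ν ∧ (h : EReal) < measEntropy f ν ∧
      ∀ i : Fin d, |(∫ x, Φ x i ∂ν) - (∫ x, Φ x i ∂μ)| < ε

end Abundance

section BowenSets
variable [MetricSpace X]

lemma exists_isSpanningSetOf_univ [CompactSpace X] {f : X → X} (hf : Continuous f) (n : ℕ)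
    {ε : ℝ} (hε : 0 < ε) : ∃ C : Finset X, IsSpanningSetOf f n ε Set.univ C := by
  have hnhds : ∀ x : X,
      {y | ∀ i ∈ Finset.range n, dist (f^[i] x) (f^[i] y) < ε} ∈ 𝓝 x := by
    intro x
    have hev : ∀ᶠ y in 𝓝 x, ∀ i ∈ Finset.range n, dist (f^[i] x) (f^[i] y) < ε := by
      rw [Filter.eventually_all_finset]
      intro i _
      have hcont : Continuous fun y => dist (f^[i] x) (f^[i] y) :=
        continuous_const.dist (hf.iterate i)
      exact hcont.continuousAt.eventually_lt continuousAt_const (by simpa using hε)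
    exact hev
  obtain ⟨C, hC⟩ := CompactSpace.elim_nhds_subcover _ hnhds
  refine ⟨C, fun y _ => ?_⟩
  have hy : y ∈ ⋃ x ∈ C, {y | ∀ i ∈ Finset.range n, dist (f^[i] x) (f^[i] y) < ε} := by
    rw [hC]; trivial
  simp only [Set.mem_iUnion, exists_prop] at hy
  obtain ⟨x, hx, hxy⟩ := hy
  exact ⟨x, hx, fun i hi => (hxy i (Finset.mem_range.2 hi)).le⟩

/-- Points of a separated set are injectively shadowed by points of a finer spanning set. -/
lemma IsSeparatedSetOf.exists_injOn {f : X → X} {n : ℕ} {ε : ℝ} {Z W : Set X} {E C : Finset X}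
    (hE : IsSeparatedSetOf f n ε Z E) (hC : IsSpanningSetOf f n (ε / 2) W C)
    (hEW : (E : Set X) ⊆ W) :
    ∃ g : X → X, (∀ x ∈ E, g x ∈ C) ∧ Set.InjOn g E ∧
      ∀ x ∈ E, ∀ i < n, dist (f^[i] (g x)) (f^[i] x) ≤ ε / 2 := by
  choose! g hgC hg using hC
  refine ⟨g, fun x hx => hgC x (hEW hx), ?_, fun x hx => hg x (hEW hx)⟩
  intro x hx y hy hxy
  by_contra hne
  obtain ⟨i, hi, hlt⟩ := hE.2 x hx y hy hne
  have hx' := hg x (hEW hx) i hi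
  have hy' := hg y (hEW hy) i hi
  rw [hxy, dist_comm] at hx'
  rw [← hxy] at hx' hy'
  have := dist_triangle (f^[i] x) (f^[i] (g x)) (f^[i] y)
  linarith

lemma exists_separated_spanning [CompactSpace X] {f : X → X} (hf : Continuous f) (n : ℕ)
    {ε : ℝ} (hε : 0 < ε) (Z : Set X) :
    ∃ E : Finset X, IsSeparatedSetOf f n ε Z E ∧ IsSpanningSetOf f n ε Z E := by
  classical
  obtain ⟨C, hC⟩ := exists_isSpanningSetOf_univ hf n (half_pos hε)
  let A : Set ℕ := {k | ∃ E : Finset X, IsSeparatedSetOf f n ε Z E ∧ E.card = k}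
  have hne : A.Nonempty := ⟨0, ∅, ⟨by simp, by simp⟩, by simp⟩
  have hbdd : BddAbove A := by
    refine ⟨C.card, ?_⟩
    rintro k ⟨E, hE, rfl⟩
    obtain ⟨g, hgC, hg, -⟩ := hE.exists_injOn hC (Set.subset_univ _)
    exact Finset.card_le_card_of_injOn g hgC hg
  obtain ⟨E, hE, hcard⟩ := Nat.sSup_mem hne hbdd
  refine ⟨E, hE, fun y hy => ?_⟩
  by_contra! hcon
  have hyE : y ∉ E := fun h => by
    obtain ⟨i, _, hi⟩ := hcon y h
    rw [dist_self] at hi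
    linarith
  have hins : IsSeparatedSetOf f n ε Z (insert y E) := by
    refine ⟨?_, ?_⟩
    · rw [Finset.coe_insert]
      exact Set.insert_subset hy hE.1
    · intro a ha b hb hab
      rw [Finset.mem_insert] at ha hb
      rcases ha with rfl | ha <;> rcases hb with rfl | hb
      · exact absurd rfl hab
      · obtain ⟨i, hi, h⟩ := hcon b hb
        exact ⟨i, hi, by rwa [dist_comm]⟩
      · exact hcon a ha
      · exact hE.2 a ha b hb hab
  have hle := le_csSup hbdd ⟨_, hins, rfl⟩
  rw [Finset.card_insert_of_notMem hyE, ← hcard] at hle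
  omega

end BowenSets

section BirkhoffSums

lemma birkhoff_succ (f : X → X) (φ : X → ℝ) (n : ℕ) (x : X) :
    birkhoff f φ (n + 1) x = birkhoff f φ n x + φ (f^[n] x) :=
  Finset.sum_range_succ _ _

lemma mul_le_birkhoff (f : X → X) {φ : X → ℝ} {m : ℝ} (h : ∀ x, m ≤ φ x) (n : ℕ) (x : X) :
    n * m ≤ birkhoff f φ n x := by
  have := Finset.card_nsmul_le_sum (Finset.range n) (fun i => φ (f^[i] x)) m fun i _ => h _
  simpa [birkhoff] using this

lemma birkhoff_le_mul (f : X → X) {φ : X → ℝ} {M : ℝ} (h : ∀ x, φ x ≤ M) (n : ℕ) (x : X) :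
    birkhoff f φ n x ≤ n * M := by
  have := Finset.sum_le_card_nsmul (Finset.range n) (fun i => φ (f^[i] x)) M fun i _ => h _
  simpa [birkhoff] using this

/-- Removing the linear term `-β b` from the weight of `G_β`. -/
lemma nlWeight_snoc (f : X → X) {d : ℕ} (Φ : X → Fin d → ℝ) (ψ : X → ℝ)
    (F : (Fin d → ℝ) → ℝ) (β : ℝ) (n : ℕ) (x : X) :
    nlWeight f (fun v : Fin (d + 1) → ℝ => F (Fin.init v) - β * v (Fin.last d))
      (fun x => Fin.snoc (Φ x) (ψ x)) n x =
    ENNReal.ofReal (Real.exp (-(β * birkhoff f ψ n x))) * nlWeight f F Φ n x := by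
  rw [nlWeight, nlWeight, ← ENNReal.ofReal_mul (Real.exp_pos _).le, ← Real.exp_add]
  have hinit : (Fin.init fun i : Fin (d + 1) =>
      birkhoffVec f (fun x => (Fin.snoc (Φ x) (ψ x) : Fin (d + 1) → ℝ)) n x i / n) =
      fun i => birkhoffVec f Φ n x i / n := by
    funext i
    simp [Fin.init, birkhoffVec, birkhoff]
  rw [hinit]
  congr 2
  rcases Nat.eq_zero_or_pos n with rfl | hn
  · simp [birkhoff]
  · have hn' : (n : ℝ) ≠ 0 := Nat.cast_ne_zero.2 hn.ne'
    simp only [birkhoffVec, Fin.snoc_last]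
    field_simp
    ring

variable [MetricSpace X]

/-- Bowen-close points have nearly the same nonlinear weight, uniformly in time. -/
lemma exists_nlWeight_le [CompactSpace X] (f : X → X) {d : ℕ} {Φ : X → Fin d → ℝ}
    (hΦ : Continuous Φ) {F : (Fin d → ℝ) → ℝ} (hF : Continuous F) {δ : ℝ} (hδ : 0 < δ) :
    ∃ ε₀ > 0, ∀ (n : ℕ) (x y : X), (∀ i < n, dist (f^[i] y) (f^[i] x) ≤ ε₀) →
      nlWeight f F Φ n x ≤ ENNReal.ofReal (Real.exp (n * δ)) * nlWeight f F Φ n y := by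
  obtain ⟨B, hB⟩ := isCompact_univ.exists_bound_of_continuousOn hΦ.continuousOn
  have huF : UniformContinuousOn F (Metric.closedBall 0 |B|) :=
    (isCompact_closedBall _ _).uniformContinuousOn_of_continuous hF.continuousOn
  obtain ⟨η, hη, hηF⟩ := Metric.uniformContinuousOn_iff.1 huF δ hδ
  obtain ⟨ρ, hρ, hρΦ⟩ := Metric.uniformContinuous_iff.1
    (CompactSpace.uniformContinuous_of_continuous hΦ) (η / 2) (half_pos hη)
  refine ⟨ρ / 2, half_pos hρ, fun n x y hxy => ?_⟩
  rw [nlWeight, nlWeight, ← ENNReal.ofReal_mul (Real.exp_pos _).le, ← Real.exp_add]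
  refine ENNReal.ofReal_le_ofReal (Real.exp_le_exp.2 ?_)
  rcases Nat.eq_zero_or_pos n with rfl | hn
  · simp
  have hn' : (0 : ℝ) < n := Nat.cast_pos.2 hn
  have hball : ∀ z, (fun i => birkhoffVec f Φ n z i / n) ∈ Metric.closedBall (0 : Fin d → ℝ) |B| := by
    intro z
    rw [mem_closedBall_zero_iff, pi_norm_le_iff_of_nonneg (abs_nonneg B)]
    intro i
    have hcoord : ∀ w, |Φ w i| ≤ |B| := fun w =>
      ((norm_le_pi_norm (Φ w) i).trans (hB w (Set.mem_univ w))).trans (le_abs_self B)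
    have h1 := mul_le_birkhoff f (φ := fun w => Φ w i) (fun w => (abs_le.1 (hcoord w)).1) n z
    have h2 := birkhoff_le_mul f (φ := fun w => Φ w i) (fun w => (abs_le.1 (hcoord w)).2) n z
    rw [Real.norm_eq_abs, abs_le, birkhoffVec, le_div_iff₀ hn', div_le_iff₀ hn']
    constructor <;> nlinarith
  have hdist : dist (fun i => birkhoffVec f Φ n x i / n) (fun i => birkhoffVec f Φ n y i / n)
      < η := by
    refine lt_of_le_of_lt ?_ (half_lt_self hη)
    rw [dist_pi_le_iff (half_pos hη).le]
    intro i
    rw [Real.dist_eq, ← sub_div, abs_div, abs_of_pos hn', div_le_iff₀ hn', birkhoffVec, birkhoffVec,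
      birkhoff, birkhoff, ← Finset.sum_sub_distrib]
    refine (Finset.abs_sum_le_sum_abs _ _).trans ?_
    have := Finset.sum_le_card_nsmul (Finset.range n)
      (fun j => |Φ (f^[j] x) i - Φ (f^[j] y) i|) (η / 2) fun j hj => by
        have hj' := hxy j (Finset.mem_range.1 hj)
        rw [dist_comm] at hj'
        have h3 := hρΦ (lt_of_le_of_lt hj' (half_lt_self hρ))
        rw [← Real.dist_eq]
        exact (dist_le_pi_dist _ _ i).trans h3.le
    rw [Finset.card_range, nsmul_eq_mul] at this
    linarith
  have hFxy := hηF _ (hball x) _ (hball y) hdist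
  rw [Real.dist_eq] at hFxy
  have := (abs_lt.1 hFxy).2
  nlinarith

end BirkhoffSums

lemma ENNReal.log_mul_inv_le_iff {a : ℝ≥0∞} {b T : ℝ} (hT : 0 < T) :
    ENNReal.log a * ((T⁻¹ : ℝ) : EReal) ≤ b ↔ a ≤ ENNReal.ofReal (Real.exp (b * T)) := by
  have hdiv : ENNReal.log a * ((T⁻¹ : ℝ) : EReal) = ENNReal.log a / (T : EReal) := rfl
  rw [hdiv, EReal.div_le_iff_le_mul (EReal.coe_pos.2 hT) (EReal.coe_ne_top T),
    ← ENNReal.log_le_log_iff, ENNReal.log_ofReal_of_pos (Real.exp_pos _), Real.log_exp, mul_comm,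
    EReal.coe_mul]

lemma tsum_ofReal_exp_neg_ne_top {c : ℝ} (hc : 0 < c) :
    ∑' n : ℕ, ENNReal.ofReal (Real.exp (-(c * n))) ≠ ⊤ := by
  have h : Summable fun n : ℕ => Real.exp (-(c * n)) := by
    have := Real.summable_exp_nat_mul_iff.2 (neg_lt_zero.2 hc)
    refine this.congr fun n => ?_
    congr 1; ring
  exact h.tsum_ofReal_ne_top

/-- Exponential growth absorbs constants. -/
lemma eventually_le_ofReal_exp_mul {K : ℝ≥0∞} (hK : K ≠ ⊤) {c : ℝ} (hc : 0 < c) :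
    ∀ᶠ T : ℝ in atTop, K ≤ ENNReal.ofReal (Real.exp (c * T)) := by
  have h := (Real.tendsto_exp_atTop.comp (tendsto_id.const_mul_atTop hc)).eventually_ge_atTop
    K.toReal
  filter_upwards [h] with T hT
  exact (ENNReal.le_ofReal_iff_toReal_le hK (Real.exp_pos _).le).2 hT

section Comparison
variable [MetricSpace X] {d : ℕ} {f : X → X} {ψ : X → ℝ}
  {Φ : X → Fin d → ℝ} {F : (Fin d → ℝ) → ℝ} {β : ℝ}

/-- A separated set inside `X_n` has total weight at most that of any spanning family, up to the
distortion of the weight at the corresponding scale. -/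
lemma sum_nlWeight_le_nlInducedQ {n : ℕ} {ε κ T : ℝ} {E : Finset X}
    (hE : IsSeparatedSetOf f n ε (inducedXn f ψ T n) E)
    (hκ : ∀ x y : X, (∀ i < n, dist (f^[i] y) (f^[i] x) ≤ ε / 2) →
      nlWeight f F Φ n x ≤ ENNReal.ofReal (Real.exp κ) * nlWeight f F Φ n y) :
    ∑ x ∈ E, nlWeight f F Φ n x ≤
      ENNReal.ofReal (Real.exp κ) * nlInducedQ f ψ F Φ T (ε / 2) := by
  classical
  rcases E.eq_empty_or_nonempty with rfl | ⟨x₀, hx₀⟩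
  · simp
  have hn : n ∈ inducedST f ψ T := ⟨x₀, hE.1 hx₀⟩
  have hpos : 0 < Real.exp κ := Real.exp_pos κ
  rw [← ENNReal.div_le_iff' (by simpa using hpos) ENNReal.ofReal_ne_top]
  refine le_iInf₂ fun C hC => ?_
  rw [ENNReal.div_le_iff' (by simpa using hpos) ENNReal.ofReal_ne_top]
  obtain ⟨g, hgC, hg, hdist⟩ := hE.exists_injOn (hC n hn) hE.1
  calc ∑ x ∈ E, nlWeight f F Φ n x
      ≤ ∑ x ∈ E, ENNReal.ofReal (Real.exp κ) * nlWeight f F Φ n (g x) :=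
        Finset.sum_le_sum fun x hx => hκ x (g x) (hdist x hx)
    _ = ENNReal.ofReal (Real.exp κ) * ∑ y ∈ E.image g, nlWeight f F Φ n y := by
        rw [← Finset.mul_sum, Finset.sum_image hg]
    _ ≤ ENNReal.ofReal (Real.exp κ) * ∑ y ∈ C n, nlWeight f F Φ n y :=
        mul_le_mul_right (Finset.sum_le_sum_of_subset (Finset.image_subset_iff.2 hgC)) _
    _ ≤ _ := mul_le_mul_right
        (ENNReal.le_tsum (f := fun k : inducedST f ψ T => ∑ y ∈ C k, nlWeight f F Φ k y) ⟨n, hn⟩) _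

variable [CompactSpace X]

lemma nlInducedPressure_le_of_nlPressure_nonpos (hf : Continuous f) {m M : ℝ} (hm : 0 < m)
    (hmψ : ∀ x, m ≤ ψ x) (hψM : ∀ x, ψ x ≤ M)
    (h : nlPressure f (fun v : Fin (d + 1) → ℝ => F (Fin.init v) - β * v (Fin.last d))
      (fun x => Fin.snoc (Φ x) (ψ x)) ≤ 0) :
    nlInducedPressure f ψ F Φ ≤ β := by
  refine EReal.le_of_forall_lt_iff_le.1 fun b hb => ?_
  have hb : 0 < b - β := sub_pos.2 (EReal.coe_lt_coe_iff.1 hb)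
  set c : ℝ := (b - β) * m / 4 with hc
  have hcpos : 0 < c := by positivity
  have hsmall := Filter.eventually_lt_of_limsup_lt (lt_of_le_of_lt h (EReal.coe_pos.2 hcpos))
  refine Filter.limsup_le_of_le (h := ?_)
  filter_upwards [hsmall, self_mem_nhdsWithin] with ε hε hεpos
  obtain ⟨N, hN⟩ := Filter.eventually_atTop.1 (Filter.eventually_lt_of_limsup_lt hε)
  set K : ℝ≥0∞ := ENNReal.ofReal (Real.exp (|β| * M)) *
    ∑' n : ℕ, ENNReal.ofReal (Real.exp (-(c * n))) with hK
  have hKtop : K ≠ ⊤ := ENNReal.mul_ne_top ENNReal.ofReal_ne_top (tsum_ofReal_exp_neg_ne_top hcpos)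
  refine Filter.limsup_le_of_le (h := ?_)
  filter_upwards [eventually_le_ofReal_exp_mul hKtop (half_pos hb), eventually_gt_atTop 0,
    eventually_ge_atTop ((N + 2) * M)] with T hKT hT hNT
  rw [ENNReal.log_mul_inv_le_iff hT]
  choose E hEsep hEspan using fun n => exists_separated_spanning hf n hεpos (inducedXn f ψ T n)
  refine (iInf₂_le E fun n _ => hEspan n).trans ?_
  have hterm : ∀ n : inducedST f ψ T, ∑ x ∈ E n, nlWeight f F Φ n x ≤
      ENNReal.ofReal (Real.exp ((β + b) / 2 * T)) * (ENNReal.ofReal (Real.exp (|β| * M)) *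
        ENNReal.ofReal (Real.exp (-(c * (n : ℕ))))) := by
    rintro ⟨n, x₀, hx₀, hx₀'⟩
    have hMpos : 0 < M := hm.trans_le ((hmψ x₀).trans (hψM x₀))
    have hNn : N + 1 ≤ n := by
      have h1 := birkhoff_le_mul f hψM (n + 1) x₀
      push_cast at h1
      have h2 : (N + 2 : ℝ) * M < (n + 1) * M := by linarith
      have h3 := lt_of_mul_lt_mul_right h2 hMpos.le
      have h4 : ((N + 1 : ℕ) : ℝ) < n := by push_cast; linarith
      exact (Nat.cast_lt.1 h4).le
    have hnpos : (0 : ℝ) < n := Nat.cast_pos.2 (by omega)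
    have hnT : n * m ≤ T := (mul_le_birkhoff f hmψ n x₀).trans hx₀
    have hsep := (ENNReal.log_mul_inv_le_iff hnpos).1 (hN n (by omega)).le
    have hsepE := (le_iSup₂_of_le (f := fun (E : Finset X)
      (_ : IsSeparatedSetOf f n ε Set.univ E) => ∑ x ∈ E, nlWeight f
        (fun v : Fin (d + 1) → ℝ => F (Fin.init v) - β * v (Fin.last d))
        (fun x => Fin.snoc (Φ x) (ψ x)) n x) (E n) ⟨Set.subset_univ _, (hEsep n).2⟩ le_rfl).trans
      hsep
    have hweight : ∀ x ∈ E n, nlWeight f F Φ n x ≤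
        ENNReal.ofReal (Real.exp (β * T + |β| * M)) * nlWeight f
          (fun v : Fin (d + 1) → ℝ => F (Fin.init v) - β * v (Fin.last d))
          (fun x => Fin.snoc (Φ x) (ψ x)) n x := by
      intro x hx
      obtain ⟨hx1, hx2⟩ := (hEsep n).1 hx
      rw [birkhoff_succ] at hx2
      have hM := hψM (f^[n] x)
      rw [nlWeight_snoc, ← mul_assoc, ← ENNReal.ofReal_mul (Real.exp_pos _).le, ← Real.exp_add]
      refine le_mul_of_one_le_left zero_le ?_
      rw [ENNReal.one_le_ofReal, Real.one_le_exp_iff]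
      have habs : -(β * (T - birkhoff f ψ n x)) ≤ |β| * M := by
        rw [← neg_mul]
        refine (le_abs_self _).trans ?_
        rw [abs_mul, abs_neg, abs_of_nonneg (sub_nonneg.2 hx1)]
        exact mul_le_mul_of_nonneg_left (by linarith) (abs_nonneg β)
      linarith
    refine (Finset.sum_le_sum hweight).trans ?_
    rw [← Finset.mul_sum]
    refine (mul_le_mul_right hsepE _).trans ?_
    rw [← ENNReal.ofReal_mul (Real.exp_pos _).le, ← ENNReal.ofReal_mul (Real.exp_pos _).le,
      ← ENNReal.ofReal_mul (Real.exp_pos _).le, ← Real.exp_add, ← Real.exp_add, ← Real.exp_add]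
    refine ENNReal.ofReal_le_ofReal (Real.exp_le_exp.2 ?_)
    rw [hc]
    dsimp only
    have := mul_le_mul_of_nonneg_left hnT hb.le
    linarith
  refine (ENNReal.tsum_le_tsum hterm).trans ?_
  rw [ENNReal.tsum_mul_left, ENNReal.tsum_mul_left]
  have hsub : ∑' n : inducedST f ψ T, ENNReal.ofReal (Real.exp (-(c * (n : ℕ)))) ≤
      ∑' n : ℕ, ENNReal.ofReal (Real.exp (-(c * n))) :=
    ENNReal.tsum_comp_le_tsum_of_injective Subtype.val_injective
      fun n : ℕ => ENNReal.ofReal (Real.exp (-(c * n)))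
  refine (mul_le_mul_right ((mul_le_mul_right hsub _).trans hKT) _).trans ?_
  rw [← ENNReal.ofReal_mul (Real.exp_pos _).le, ← Real.exp_add]
  exact ENNReal.ofReal_le_ofReal (Real.exp_le_exp.2 (by linarith))

lemma nlPressure_neg_of_nlInducedPressure_lt (hΦ : Continuous Φ) (hF : Continuous F)
    {m : ℝ} (hm : 0 < m) (hmψ : ∀ x, m ≤ ψ x) (h : nlInducedPressure f ψ F Φ < β) :
    nlPressure f (fun v : Fin (d + 1) → ℝ => F (Fin.init v) - β * v (Fin.last d))
      (fun x => Fin.snoc (Φ x) (ψ x)) < 0 := by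
  classical
  obtain ⟨b, hb, hbβ⟩ := EReal.lt_iff_exists_real_btwn.1 h
  have hγ : 0 < β - b := sub_pos.2 (EReal.coe_lt_coe_iff.1 hbβ)
  set c : ℝ := (β - b) * m / 8 with hc
  have hcpos : 0 < c := by positivity
  obtain ⟨ε₀, hε₀, hdistort⟩ := exists_nlWeight_le f hΦ hF (δ := 2 * c) (by positivity)
  have hhalf : Tendsto (fun ε : ℝ => ε / 2) (𝓝[>] 0) (𝓝[>] 0) := by
    refine tendsto_nhdsWithin_iff.2 ⟨?_, ?_⟩
    · have : Tendsto (fun ε : ℝ => ε / 2) (𝓝 0) (𝓝 (0 / 2)) := tendsto_id.div_const 2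
      rw [zero_div] at this
      exact this.mono_left nhdsWithin_le_nhds
    · filter_upwards [self_mem_nhdsWithin] with ε hε using half_pos (Set.mem_Ioi.1 hε)
  have hsmall := hhalf.eventually (Filter.eventually_lt_of_limsup_lt hb)
  have hle₀ : ∀ᶠ ε : ℝ in 𝓝[>] 0, ε / 2 ≤ ε₀ :=
    hhalf.eventually (nhdsWithin_le_nhds (Iic_mem_nhds hε₀))
  suffices hle : nlPressure f (fun v : Fin (d + 1) → ℝ => F (Fin.init v) - β * v (Fin.last d))
      (fun x => Fin.snoc (Φ x) (ψ x)) ≤ ((-c : ℝ) : EReal) from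
    hle.trans_lt (EReal.coe_neg'.2 (neg_lt_zero.2 hcpos))
  refine Filter.limsup_le_of_le (h := ?_)
  filter_upwards [hsmall, hle₀] with ε hε hεle
  obtain ⟨T₀, hT₀⟩ := Filter.eventually_atTop.1 (Filter.eventually_lt_of_limsup_lt hε)
  set K : ℝ≥0∞ := ENNReal.ofReal (Real.exp (|β| * m)) *
    ∑' k : ℕ, ENNReal.ofReal (Real.exp (-(4 * c * k))) with hK
  have hKtop : K ≠ ⊤ :=
    ENNReal.mul_ne_top ENNReal.ofReal_ne_top (tsum_ofReal_exp_neg_ne_top (by positivity))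
  refine Filter.limsup_le_of_le (h := ?_)
  filter_upwards [tendsto_natCast_atTop_atTop.eventually (eventually_le_ofReal_exp_mul hKtop hcpos),
    eventually_gt_atTop 0, tendsto_natCast_atTop_atTop.eventually (eventually_ge_atTop (T₀ / m))]
    with n hKn hn hnT₀
  have hn' : (0 : ℝ) < n := Nat.cast_pos.2 hn
  rw [div_le_iff₀ hm] at hnT₀
  rw [ENNReal.log_mul_inv_le_iff hn']
  refine iSup₂_le fun E hE => ?_
  let k : X → ℕ := fun x => ⌈birkhoff f ψ n x / m⌉₊
  have hSpos : ∀ x, 0 ≤ birkhoff f ψ n x := fun x =>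
    (by positivity : 0 ≤ (n : ℝ) * m).trans (mul_le_birkhoff f hmψ n x)
  have hk₁ : ∀ x, birkhoff f ψ n x ≤ k x * m := fun x => (div_le_iff₀ hm).1 (Nat.le_ceil _)
  have hk₂ : ∀ x, k x * m < birkhoff f ψ n x + m := fun x => by
    have := Nat.ceil_lt_add_one (div_nonneg (hSpos x) hm.le)
    calc (k x : ℝ) * m < (birkhoff f ψ n x / m + 1) * m := mul_lt_mul_of_pos_right this hm
      _ = _ := by field_simp
  have hfiber : ∀ j ∈ E.image k, ∑ x ∈ E with k x = j, nlWeight f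
      (fun v : Fin (d + 1) → ℝ => F (Fin.init v) - β * v (Fin.last d))
      (fun x => Fin.snoc (Φ x) (ψ x)) n x ≤
      ENNReal.ofReal (Real.exp (-(2 * c * n))) * (ENNReal.ofReal (Real.exp (|β| * m)) *
        ENNReal.ofReal (Real.exp (-(4 * c * j)))) := by
    intro j hj
    obtain ⟨x₀, -, rfl⟩ := Finset.mem_image.1 hj
    have hnk : (n : ℝ) * m ≤ k x₀ * m := (mul_le_birkhoff f hmψ n x₀).trans (hk₁ x₀)
    have hTpos : 0 < (k x₀ : ℝ) * m := (by positivity : 0 < (n : ℝ) * m).trans_le hnk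
    have hQ := (ENNReal.log_mul_inv_le_iff hTpos).1 (hT₀ (k x₀ * m) (hnT₀.trans hnk)).le
    have hsep : IsSeparatedSetOf f n ε (inducedXn f ψ (k x₀ * m) n) {x ∈ E | k x = k x₀} := by
      refine ⟨fun x hx => ?_, fun x hx y hy => hE.2 x (Finset.mem_filter.1 hx).1 y
        (Finset.mem_filter.1 hy).1⟩
      rw [← (Finset.mem_filter.1 hx).2]
      refine ⟨hk₁ x, ?_⟩
      rw [birkhoff_succ]
      linarith [hk₂ x, hmψ (f^[n] x)]
    have hsum := sum_nlWeight_le_nlInducedQ (F := F) (Φ := Φ) (κ := n * (2 * c)) hsep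
      fun x y hxy => hdistort n x y fun i hi => (hxy i hi).trans hεle
    have hweight : ∀ x ∈ ({x ∈ E | k x = k x₀} : Finset X), nlWeight f
        (fun v : Fin (d + 1) → ℝ => F (Fin.init v) - β * v (Fin.last d))
        (fun x => Fin.snoc (Φ x) (ψ x)) n x ≤
        ENNReal.ofReal (Real.exp (|β| * m - β * (k x₀ * m))) * nlWeight f F Φ n x := by
      intro x hx
      have hkx := (Finset.mem_filter.1 hx).2
      have h1 := hk₁ x
      have h2 := hk₂ x
      rw [hkx] at h1 h2
      rw [nlWeight_snoc]
      refine mul_le_mul_left (ENNReal.ofReal_le_ofReal (Real.exp_le_exp.2 ?_)) _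
      have habs : β * (k x₀ * m - birkhoff f ψ n x) ≤ |β| * m := by
        refine (le_abs_self _).trans ?_
        rw [abs_mul, abs_of_nonneg (sub_nonneg.2 h1)]
        exact mul_le_mul_of_nonneg_left (by linarith) (abs_nonneg β)
      linarith
    refine (Finset.sum_le_sum hweight).trans ?_
    rw [← Finset.mul_sum]
    refine (mul_le_mul_right (hsum.trans (mul_le_mul_right hQ _)) _).trans ?_
    rw [← ENNReal.ofReal_mul (Real.exp_pos _).le, ← ENNReal.ofReal_mul (Real.exp_pos _).le,
      ← ENNReal.ofReal_mul (Real.exp_pos _).le, ← ENNReal.ofReal_mul (Real.exp_pos _).le,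
      ← Real.exp_add, ← Real.exp_add, ← Real.exp_add, ← Real.exp_add]
    refine ENNReal.ofReal_le_ofReal (Real.exp_le_exp.2 ?_)
    rw [hc]
    have := mul_le_mul_of_nonneg_left hnk hγ.le
    linarith
  rw [← Finset.sum_fiberwise_of_maps_to (fun x hx => Finset.mem_image_of_mem k hx)]
  refine (Finset.sum_le_sum hfiber).trans ?_
  refine (ENNReal.sum_le_tsum _).trans ?_
  rw [ENNReal.tsum_mul_left, ENNReal.tsum_mul_left]
  refine (mul_le_mul_right hKn _).trans ?_
  rw [← ENNReal.ofReal_mul (Real.exp_pos _).le, ← Real.exp_add]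
  exact ENNReal.ofReal_le_ofReal (Real.exp_le_exp.2 (by linarith))

end Comparison

/-- Let `Ψ = (Φ, ψ) ∈ C(X,ℝ)^{d+1}` and, for `β ∈ ℝ`,
`G_β(a,b) = F(a) − βb`. If `(f,Ψ)` has an abundance of ergodic measures, or `F` is
convex, then `P^F_ψ(Φ) = inf{β : P^{G_β}(Ψ) ≤ 0} = sup{β : P^{G_β}(Ψ) ≥ 0}`. -/
theorem nlInducedPressure_eq_inf_sup
    {X : Type*} [MetricSpace X] [CompactSpace X] [Nonempty X]
    [MeasurableSpace X] [BorelSpace X] {d : ℕ}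
    (f : X → X) (hf : Continuous f)
    (ψ : X → ℝ) (hψ : Continuous ψ) (hψpos : ∀ x, 0 < ψ x)
    (Φ : X → Fin d → ℝ) (hΦ : Continuous Φ)
    (F : (Fin d → ℝ) → ℝ) (hF : Continuous F)
    (hcond : HasAbundanceOfErgodicMeasures f (fun x => Fin.snoc (Φ x) (ψ x)) ∨
      ConvexOn ℝ Set.univ F) :
    nlInducedPressure f ψ F Φ =
        sInf {b : EReal | ∃ β : ℝ, b = (β : EReal) ∧
          nlPressure f (fun v : Fin (d + 1) → ℝ => F (Fin.init v) - β * v (Fin.last d))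
            (fun x => Fin.snoc (Φ x) (ψ x)) ≤ 0} ∧
      nlInducedPressure f ψ F Φ =
        sSup {b : EReal | ∃ β : ℝ, b = (β : EReal) ∧
          0 ≤ nlPressure f (fun v : Fin (d + 1) → ℝ => F (Fin.init v) - β * v (Fin.last d))
            (fun x => Fin.snoc (Φ x) (ψ x))} := by
  obtain ⟨x₀, -, hx₀⟩ := isCompact_univ.exists_isMinOn Set.univ_nonempty hψ.continuousOn
  obtain ⟨x₁, -, hx₁⟩ := isCompact_univ.exists_isMaxOn Set.univ_nonempty hψ.continuousOn
  have hmin : ∀ x, ψ x₀ ≤ ψ x := fun x => hx₀ (Set.mem_univ x)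
  have hmax : ∀ x, ψ x ≤ ψ x₁ := fun x => hx₁ (Set.mem_univ x)
  have hupper : ∀ β : ℝ,
      nlPressure f (fun v : Fin (d + 1) → ℝ => F (Fin.init v) - β * v (Fin.last d))
        (fun x => Fin.snoc (Φ x) (ψ x)) ≤ 0 → nlInducedPressure f ψ F Φ ≤ β :=
    fun β => nlInducedPressure_le_of_nlPressure_nonpos hf (hψpos x₀) hmin hmax
  have hlower : ∀ β : ℝ, nlInducedPressure f ψ F Φ < β →
      nlPressure f (fun v : Fin (d + 1) → ℝ => F (Fin.init v) - β * v (Fin.last d))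
        (fun x => Fin.snoc (Φ x) (ψ x)) < 0 :=
    fun β => nlPressure_neg_of_nlInducedPressure_lt hΦ hF (hψpos x₀) hmin
  constructor
  · refine le_antisymm (le_sInf ?_) (EReal.le_of_forall_lt_iff_le.1 fun β hβ => ?_)
    · rintro _ ⟨β, rfl, hβ⟩
      exact hupper β hβ
    · exact sInf_le ⟨β, rfl, (hlower β hβ).le⟩
  · refine le_antisymm (EReal.ge_of_forall_gt_iff_ge.1 fun β hβ => ?_) (sSup_le ?_)
    · exact le_sSup ⟨β, rfl, not_lt.1 fun hneg => hβ.not_ge (hupper β hneg.le)⟩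
    · rintro _ ⟨β, rfl, hβ⟩
      exact not_lt.1 fun hlt => (hlower β hlt).not_ge hβ
end
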